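/- Let g(x) := (x+1)·log₂(x+1) − x·log₂(x) for x > 0 and g(0) := 0, where log₂ denotes the base-2 logarithm. Fix κ > 1. Then, as n̄ tends to 0 from the right, the quantity (g((1+κ)·n̄/2 + (κ−1)/2) − g((κ−1)·(n̄+1)/2)) / n̄ converges to log₂((κ+1)/(κ−1)). -/

import Mathlib

/-- `g x = (x+1) log₂ (x+1) - x log₂ x`, with `g 0 = 0` (automatic from
Mathlib's convention `Real.log 0 = 0`). -/
noncomputable def g (x : ℝ) : ℝ :=
  (x + 1) * Real.logb 2 (x + 1) - x * Real.logb 2 x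

/-- The derivative of `g` at a positive point. -/
theorem hasDerivAt_g {x : ℝ} (hx : 0 < x) :
    HasDerivAt g (Real.logb 2 ((x + 1) / x)) x := by
  have h1 : HasDerivAt (fun y : ℝ => (y + 1) * Real.log (y + 1)) (Real.log (x + 1) + 1) x :=
    (Real.hasDerivAt_mul_log (by positivity : x + 1 ≠ 0)).comp_add_const x 1
  have hg : g = fun y => ((y + 1) * Real.log (y + 1) - y * Real.log y) / Real.log 2 := by
    ext y
    simp only [g, Real.logb]
    ring
  have hlog : Real.logb 2 ((x + 1) / x) =
      (Real.log (x + 1) + 1 - (Real.log x + 1)) / Real.log 2 := by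
    rw [Real.logb, Real.log_div (by positivity) hx.ne']
    ring
  rw [hg, hlog]
  exact (h1.sub (Real.hasDerivAt_mul_log hx.ne')).div_const (Real.log 2)

/-- Squashed-entanglement upper bound on the two-way-assisted private capacity
per unit cost of the quantum-limited amplifier:
`(g ((1+κ) n̄/2 + (κ-1)/2) - g ((κ-1)(n̄+1)/2)) / n̄ → log₂ ((κ+1)/(κ-1))`
as `n̄ → 0⁺`. -/
theorem two_way_amplifier_bound_per_unit_cost (κ : ℝ) (hκ : 1 < κ) :
    Filter.Tendsto
      (fun n : ℝ =>
        (g ((1 + κ) * n / 2 + (κ - 1) / 2) - g ((κ - 1) * (n + 1) / 2)) / n)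
      (nhdsWithin 0 (Set.Ioi 0))
      (nhds (Real.logb 2 ((κ + 1) / (κ - 1)))) := by
  have ha : 0 < (κ - 1) / 2 := by linarith
  have hu : HasDerivAt (fun n : ℝ => (1 + κ) * n / 2 + (κ - 1) / 2) ((1 + κ) / 2) 0 := by
    simpa using (((hasDerivAt_id (0 : ℝ)).const_mul (1 + κ)).div_const 2).add_const ((κ - 1) / 2)
  have hv : HasDerivAt (fun n : ℝ => (κ - 1) * (n + 1) / 2) ((κ - 1) / 2) 0 := by
    simpa using (((hasDerivAt_id (0 : ℝ)).add_const 1).const_mul (κ - 1)).div_const 2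
  have hd := ((hasDerivAt_g ha).comp_of_eq 0 hu (by simp)).sub
    ((hasDerivAt_g ha).comp_of_eq 0 hv (by simp))
  have hratio : ((κ - 1) / 2 + 1) / ((κ - 1) / 2) = (κ + 1) / (κ - 1) := by
    have : κ - 1 ≠ 0 := by linarith
    field_simp
    ring
  rw [hratio, ← mul_sub, show (1 + κ) / 2 - (κ - 1) / 2 = 1 by ring, mul_one] at hd
  refine hd.tendsto_slope_zero_right.congr fun n => ?_
  simp [div_eq_inv_mul]
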